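/- arXiv:2408.08223 — 2 statements merged into one kernel-verified Lean document; each statement's English description precedes it below -/
import Mathlib

section
/- Let q ≥ 2 and k, ℓ ≥ 1 be integers, and let x ∈ Z_q^n and x' ∈ Z_q^{n'}. Then D_k^*(R_ℓ(x)) ∩ D_k^*(R_ℓ(x')) ≠ ∅ if and only if N_{k,ℓ}(x) = N_{k,ℓ}(x'). -/
/-- The composition of a word over `Fin q`, as an element of `ℤ^q`:
it counts, for each letter `a`, the number of occurrences of `a`. -/
def comp {q : ℕ} (w : List (Fin q)) : Fin q → ℤ := fun a => (w.count a : ℤ)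

/-- The `ℓ`-read vector of a word over `Fin q`: a word of length `n + ℓ - 1`
over `ℤ^q` whose `p`-th entry is the composition of the window of the last `ℓ`
symbols ending at position `p` (symbols outside the word are omitted). -/
def readVec {q : ℕ} (ℓ : ℕ) (x : List (Fin q)) : List (Fin q → ℤ) :=
  (List.range (x.length + ℓ - 1)).map fun p => comp ((x.take (p + 1)).drop (p + 1 - ℓ))

/-- The `k`-step derivative of a word over an abelian group, with the
convention that entries at nonpositive positions are `0`. -/
def kderiv {G : Type*} [AddCommGroup G] (k : ℕ) (y : List G) : List G :=
  (List.range y.length).map fun i => y.getD i 0 - if k ≤ i then y.getD (i - k) 0 else 0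

/-- The lengths `(m_0, m_1, ..., m_s)` of the maximal (possibly empty) runs of
zeros in `y = 0^{m_0} y_1 0^{m_1} ⋯ y_s 0^{m_s}` with `y_1, ..., y_s ≠ 0`. -/
def zeroRuns {G : Type*} [Zero G] [DecidableEq G] (y : List G) : List ℕ :=
  (y.splitOnP fun a => decide (a ≠ 0)).map List.length

/-- `σ_k(y) = (⌊m_0/k⌋, ⌊m_1/k⌋, ..., ⌊m_s/k⌋)`. -/
def sigmak {G : Type*} [Zero G] [DecidableEq G] (k : ℕ) (y : List G) : List ℕ :=
  (zeroRuns y).map fun m => m / k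

/-- Interleave zero runs of the given lengths with the given (nonzero) letters:
`assemble (m_0 :: ... :: m_s) (y_1 :: ... :: y_s) = 0^{m_0} y_1 0^{m_1} ⋯ y_s 0^{m_s}`. -/
def assemble {G : Type*} [Zero G] : List ℕ → List G → List G
  | [], _ => []
  | m :: _, [] => List.replicate m (0 : G)
  | m :: ms, a :: as => List.replicate m (0 : G) ++ a :: assemble ms as

/-- `μ_k(y) = 0^{m_0 % k} y_1 0^{m_1 % k} ⋯ y_s 0^{m_s % k}`. -/
def muk {G : Type*} [Zero G] [DecidableEq G] (k : ℕ) (y : List G) : List G :=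
  assemble ((zeroRuns y).map fun m => m % k) (y.filter fun a => decide (a ≠ 0))

/-- The nucleus `N_{k,ℓ}(x) = μ_k(Δ_k(R_ℓ(x)))` of a word over `Fin q`. -/
def nucleus {q : ℕ} (k ℓ : ℕ) (x : List (Fin q)) : List (Fin q → ℤ) :=
  muk k (kderiv k (readVec ℓ x))

/-- A single tandem duplication of length `k`: `u v w ↦ u v v w` with `|v| = k`. -/
def TD {α : Type*} (k : ℕ) (y z : List α) : Prop :=
  ∃ u v w : List α, v.length = k ∧ y = u ++ (v ++ w) ∧ z = u ++ (v ++ (v ++ w))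

/-- `TDt k t y z` holds iff `z` arises from `y` by a sequence of exactly `t`
tandem duplications of length `k`, i.e. `y ⟹_k^t z`. -/
def TDt {α : Type*} (k : ℕ) : ℕ → List α → List α → Prop
  | 0 => fun y z => y = z
  | t + 1 => fun y z => ∃ w, TDt k t y w ∧ TD k w z

/-- The ball `B_{k,t}(y)`: all words obtained from `y` by at most `t` tandem
duplications of length `k`. -/
def Ball {α : Type*} (k t : ℕ) (y : List α) : Set (List α) :=
  {z | ∃ j ≤ t, TDt k j y z}

/-- `x` is `(k,ℓ)`-fine: it contains no `k`-periodic factor of length `2k+ℓ-1`. -/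
def Fine {q : ℕ} (k ℓ : ℕ) (x : List (Fin q)) : Prop :=
  ∀ i : ℕ, 1 ≤ i → i + 2 * k + ℓ - 2 ≤ x.length →
    (x.drop (i - 1)).take (k + ℓ - 1) ≠ (x.drop (i - 1 + k)).take (k + ℓ - 1)

/-- `y` contains the factor `0^k` (a run of `k` consecutive zeros). -/
def HasZeroBlock {G : Type*} [Zero G] (k : ℕ) (y : List G) : Prop :=
  ∃ j, j + k ≤ y.length ∧ (y.drop j).take k = List.replicate k (0 : G)

/-- `λ_{m,q}`: the largest real root of `x^{m+2} - q·x^{m+1} + q - 1`. -/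
noncomputable def lambdaRoot (m q : ℕ) : ℝ :=
  sSup {x : ℝ | x ^ (m + 2) - (q : ℝ) * x ^ (m + 1) + (q : ℝ) - 1 = 0}

/-- The dot product `a ⊙ b = Σ_{i=1}^{min(|a|,|b|)} a_i · b_i`. -/
def dot {G : Type*} [AddCommMonoid G] (a : List ℕ) (b : List G) : G :=
  (List.zipWith (fun m g => m • g) a b).sum

theorem exists_TDt_iff_reflTransGen {α : Type*} {k : ℕ} {y z : List α} :
    (∃ t, TDt k t y z) ↔ Relation.ReflTransGen (TD k) y z := by
  constructor
  · rintro ⟨t, h⟩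
    induction t generalizing z with
    | zero => exact h ▸ .refl
    | succ t ih =>
      obtain ⟨w, hw, hz⟩ := h
      exact (ih hw).tail hz
  · intro h
    induction h with
    | refl => exact ⟨0, rfl⟩
    | tail _ hz ih =>
      obtain ⟨t, ht⟩ := ih
      exact ⟨t + 1, _, ht, hz⟩

/-- `b` arises from `a` by inserting `0^k` at some position which is at least `k`. -/
def ZeroInsertion {G : Type*} [Zero G] (k : ℕ) (a b : List G) : Prop :=
  ∃ p s : List G, k ≤ p.length ∧ a = p ++ s ∧ b = p ++ (List.replicate k 0 ++ s)

theorem ZeroInsertion.diamond {G : Type*} [Zero G] {k : ℕ} {a b c : List G}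
    (hab : ZeroInsertion k a b) (hac : ZeroInsertion k a c) :
    ∃ d, ZeroInsertion k b d ∧ ZeroInsertion k c d := by
  obtain ⟨p, s, hp, rfl, rfl⟩ := hab
  obtain ⟨p', s', hp', h, rfl⟩ := hac
  obtain ⟨t, rfl, rfl⟩ | ⟨t, rfl, rfl⟩ := List.append_eq_append_iff.1 h
  · exact ⟨p ++ (List.replicate k 0 ++ (t ++ (List.replicate k 0 ++ s'))),
      ⟨p ++ (List.replicate k 0 ++ t), s', by simp; omega, by simp, by simp⟩,
      ⟨p, t ++ (List.replicate k 0 ++ s'), hp, by simp, by simp⟩⟩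
  · exact ⟨p' ++ (List.replicate k 0 ++ (t ++ (List.replicate k 0 ++ s))),
      ⟨p', t ++ (List.replicate k 0 ++ s), hp', by simp, by simp⟩,
      ⟨p' ++ (List.replicate k 0 ++ t), s, by simp; omega, by simp, by simp⟩⟩

theorem ZeroInsertion.exists_common {G : Type*} [Zero G] {k : ℕ} {a b c : List G}
    (hab : Relation.ReflTransGen (ZeroInsertion k) a b)
    (hac : Relation.ReflTransGen (ZeroInsertion k) a c) :
    ∃ d, Relation.ReflTransGen (ZeroInsertion k) b d ∧
      Relation.ReflTransGen (ZeroInsertion k) c d :=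
  Relation.church_rosser
    (fun _ _ _ h h' =>
      let ⟨d, hd, hd'⟩ := h.diamond h'
      ⟨d, .single hd, .single hd'⟩) hab hac

section Derivative

variable {G : Type*} [AddCommGroup G] {k : ℕ}

@[simp]
theorem length_kderiv (y : List G) : (kderiv k y).length = y.length := by
  simp [kderiv]

theorem getElem_kderiv (y : List G) (i : ℕ) (h : i < (kderiv k y).length) :
    (kderiv k y)[i] = y.getD i 0 - if k ≤ i then y.getD (i - k) 0 else 0 := by
  simp [kderiv]

theorem kderiv_injective (hk : 1 ≤ k) : Function.Injective (kderiv (G := G) k) := by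
  intro y z h
  have hlen : y.length = z.length := by simpa using congrArg List.length h
  have key : ∀ i, i < y.length → y.getD i 0 = z.getD i 0 := by
    intro i
    induction i using Nat.strong_induction_on with
    | _ i ih =>
      intro hi
      have hy := getElem_kderiv (k := k) y i (by simpa using hi)
      have hz := getElem_kderiv (k := k) z i (by simpa [← hlen] using hi)
      simp only [h] at hy
      rw [hy] at hz
      split_ifs at hz with hki
      · rw [ih (i - k) (by omega) (by omega)] at hz
        exact sub_left_injective hz
      · exact sub_left_injective hz
  refine List.ext_getElem hlen fun i hi hi' => ?_
  simpa [hi, hi'] using key i hi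

theorem kderiv_duplicate (u v w : List G) (hv : v.length = k) :
    kderiv k (u ++ (v ++ (v ++ w))) =
      (kderiv k (u ++ (v ++ w))).take (u.length + k) ++
        (List.replicate k 0 ++ (kderiv k (u ++ (v ++ w))).drop (u.length + k)) := by
  have hlow : ∀ i < u.length + k, (u ++ (v ++ (v ++ w))).getD i 0 = (u ++ (v ++ w)).getD i 0 := by
    intro i hi
    simp only [List.getD_eq_getElem?_getD, List.getElem?_append]
    grind
  have hhigh : ∀ i, u.length ≤ i →
      (u ++ (v ++ (v ++ w))).getD (i + k) 0 = (u ++ (v ++ w)).getD i 0 := by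
    intro i hi
    obtain ⟨j, rfl⟩ := Nat.exists_eq_add_of_le hi
    rw [List.getD_append_right _ _ _ _ hi, List.getD_append_right _ _ _ _ (by omega),
      List.getD_append_right _ _ _ _ (by omega)]
    congr 1
    omega
  refine List.ext_getElem (by simp; omega) fun i hi _ => ?_
  simp only [length_kderiv, List.length_append] at hi
  have hmin : min (u.length + k) (u.length + (v.length + w.length)) = u.length + k := by omega
  simp only [List.getElem_append, List.getElem_take, List.getElem_drop, List.getElem_replicate,
    getElem_kderiv, List.length_take, List.length_replicate, length_kderiv, List.length_append,
    hmin]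
  split_ifs
  any_goals omega
  · rw [hlow i (by omega), hlow (i - k) (by omega)]
  · obtain ⟨j, rfl⟩ := Nat.exists_eq_add_of_le' (show k ≤ i by omega)
    rw [hhigh j (by omega), Nat.add_sub_cancel, hlow j (by omega), sub_self]
  · obtain ⟨j, rfl⟩ := Nat.exists_eq_add_of_le' (show u.length + k + k ≤ i by omega)
    rw [← add_assoc, Nat.add_sub_cancel, hhigh _ (by omega), ← add_assoc, hhigh _ (by omega)]
    congr 2 <;> omega
  · rw [hlow i (by omega)]

theorem TD.zeroInsertion_kderiv {y z : List G} (h : TD k y z) :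
    ZeroInsertion k (kderiv k y) (kderiv k z) := by
  obtain ⟨u, v, w, hv, rfl, rfl⟩ := h
  exact ⟨_, _, by simp; omega, (List.take_append_drop (u.length + k) _).symm,
    kderiv_duplicate u v w hv⟩

theorem ZeroInsertion.exists_TD {y c : List G} (h : ZeroInsertion k (kderiv k y) c) :
    ∃ z, TD k y z ∧ kderiv k z = c := by
  obtain ⟨p, s, hp, hy, rfl⟩ := h
  have hlen : y.length = p.length + s.length := by simpa using congrArg List.length hy
  obtain ⟨u, v, w, hu, hv, rfl⟩ :
      ∃ u v w : List G, u.length + k = p.length ∧ v.length = k ∧ y = u ++ (v ++ w) :=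
    ⟨y.take (p.length - k), (y.drop (p.length - k)).take k, (y.drop (p.length - k)).drop k,
      by simp; omega, by simp; omega, by simp only [List.take_append_drop]⟩
  refine ⟨_, ⟨u, v, w, hv, rfl, rfl⟩, ?_⟩
  rw [kderiv_duplicate u v w hv, hy, hu]
  simp

theorem ZeroInsertion.exists_reflTransGen_TD {y c : List G}
    (h : Relation.ReflTransGen (ZeroInsertion k) (kderiv k y) c) :
    ∃ z, Relation.ReflTransGen (TD k) y z ∧ kderiv k z = c := by
  induction h with
  | refl => exact ⟨y, .refl, rfl⟩
  | tail _ hc ih =>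
    obtain ⟨z, hz, rfl⟩ := ih
    obtain ⟨z', hz', rfl⟩ := hc.exists_TD
    exact ⟨z', hz.tail hz', rfl⟩

theorem kderiv_eq_take_append (y : List G) :
    kderiv k y = y.take k ++ (kderiv k y).drop k := by
  conv_lhs => rw [← List.take_append_drop k (kderiv k y)]
  congr 1
  refine List.ext_getElem (by simp) fun i hi hi' => ?_
  simp only [List.length_take, length_kderiv, lt_min_iff] at hi
  simp [getElem_kderiv, hi.1, hi.2]

theorem kderiv_replicate_zero (m : ℕ) :
    kderiv k (List.replicate m (0 : G)) = List.replicate m 0 :=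
  List.ext_getElem (by simp) fun i hi hi' => by
    simp only [getElem_kderiv, List.getElem_replicate, List.getD_eq_getElem?_getD,
      List.getElem?_replicate]
    split_ifs <;> simp

end Derivative

section Reduction

variable {G : Type*} [Zero G] {k : ℕ}

theorem zeroRun_induction {P : List G → Prop} (replicate : ∀ m, P (List.replicate m 0))
    (append : ∀ m b l, b ≠ 0 → P l → P (List.replicate m 0 ++ b :: l)) (a : List G) : P a := by
  suffices h : ∀ m, P (List.replicate m 0 ++ a) by simpa using h 0
  induction a with
  | nil => simpa using replicate
  | cons b l ih =>
    intro m
    by_cases hb : b = 0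
    · subst hb
      simpa [List.replicate_succ'] using ih (m + 1)
    · exact append m b l hb (by simpa using ih 0)

theorem ZeroInsertion.reflTransGen_mod (p s : List G) (hp : k ≤ p.length) (m : ℕ) :
    Relation.ReflTransGen (ZeroInsertion k) (p ++ (List.replicate (m % k) 0 ++ s))
      (p ++ (List.replicate m 0 ++ s)) := by
  suffices h : ∀ j, Relation.ReflTransGen (ZeroInsertion k)
      (p ++ (List.replicate (m % k) 0 ++ s))
      (p ++ (List.replicate (m % k + k * j) 0 ++ s)) by
    simpa [Nat.mod_add_div] using h (m / k)
  intro j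
  induction j with
  | zero => exact .refl
  | succ j ih =>
    refine ih.tail ⟨p, _, hp, rfl, ?_⟩
    rw [Nat.mul_succ, ← add_assoc, add_comm _ k, List.replicate_add, List.append_assoc]

variable [DecidableEq G]

@[simp]
theorem muk_replicate_zero (m : ℕ) :
    muk k (List.replicate m (0 : G)) = List.replicate (m % k) 0 := by
  have h : zeroRuns (List.replicate m (0 : G)) = [m] := by
    rw [zeroRuns, List.splitOnP_eq_singleton (by simp)]
    simp
  simp [muk, h, assemble]

theorem muk_replicate_append_cons (m : ℕ) {b : G} (hb : b ≠ 0) (l : List G) :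
    muk k (List.replicate m 0 ++ b :: l) = List.replicate (m % k) 0 ++ b :: muk k l := by
  have h : zeroRuns (List.replicate m 0 ++ b :: l) = m :: zeroRuns l := by
    rw [zeroRuns, List.splitOnP_append_cons_of_forall_mem (by simp) _ (by simpa using hb)]
    simp [zeroRuns]
  simp [muk, h, assemble, hb]

theorem muk_append_of_forall_ne_zero {p : List G} (hp : ∀ b ∈ p, b ≠ 0) (l : List G) :
    muk k (p ++ l) = p ++ muk k l := by
  induction p with
  | nil => rfl
  | cons b p ih =>
    simp only [List.mem_cons, forall_eq_or_imp] at hp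
    simpa [ih hp.2] using muk_replicate_append_cons (k := k) 0 hp.1 (p ++ l)

theorem muk_append_replicate_append (p s : List G) :
    muk k (p ++ (List.replicate k 0 ++ s)) = muk k (p ++ s) := by
  induction p using zeroRun_induction with
  | replicate m =>
    induction s using zeroRun_induction with
    | replicate j =>
      simp only [← List.replicate_add, muk_replicate_zero]
      congr 1
      rw [add_left_comm, Nat.add_mod_left]
    | append j b l hb _ =>
      simp only [← List.append_assoc, ← List.replicate_add, muk_replicate_append_cons _ hb]
      congr 2
      rw [add_left_comm, Nat.add_mod_left]
  | append m b l hb ih =>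
    simp only [List.append_assoc, List.cons_append, muk_replicate_append_cons _ hb, ih]

theorem ZeroInsertion.muk_eq {a b : List G} (h : ZeroInsertion k a b) : muk k a = muk k b := by
  obtain ⟨p, s, _, rfl, rfl⟩ := h
  exact (muk_append_replicate_append p s).symm

theorem ZeroInsertion.reflTransGen_append_muk (p a : List G) (hp : k ≤ p.length) :
    Relation.ReflTransGen (ZeroInsertion k) (p ++ muk k a) (p ++ a) := by
  induction a using zeroRun_induction generalizing p with
  | replicate m => simpa using ZeroInsertion.reflTransGen_mod p [] hp m
  | append m b l hb ih =>
    rw [muk_replicate_append_cons m hb]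
    refine (ZeroInsertion.reflTransGen_mod p _ hp m).trans ?_
    have e (t) : p ++ (List.replicate m 0 ++ b :: t) = p ++ (List.replicate m 0 ++ [b]) ++ t := by
      simp
    rw [e l, e (muk k l)]
    exact ih (p ++ (List.replicate m 0 ++ [b])) (by simp; omega)

end Reduction

theorem reflTransGen_muk_kderiv {G : Type*} [AddCommGroup G] [DecidableEq G] {k : ℕ}
    {y : List G} (hy : ∀ b ∈ y, b ≠ 0) :
    Relation.ReflTransGen (ZeroInsertion k) (muk k (kderiv k y)) (kderiv k y) := by
  rw [kderiv_eq_take_append,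
    muk_append_of_forall_ne_zero fun b hb => hy b (List.mem_of_mem_take hb)]
  obtain h | h := le_total k y.length
  · exact ZeroInsertion.reflTransGen_append_muk _ _ (by simpa using h)
  · have hd : (kderiv k y).drop k = List.replicate 0 0 := by simpa using h
    rw [hd, muk_replicate_zero]
    simpa using Relation.ReflTransGen.refl

theorem comp_ne_zero {q : ℕ} {w : List (Fin q)} (hw : w ≠ []) : comp w ≠ 0 := by
  obtain ⟨a, ha⟩ := List.exists_mem_of_ne_nil w hw
  intro h
  have := congrFun h a
  simp only [comp, Pi.zero_apply, Nat.cast_eq_zero, List.count_eq_zero] at this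
  exact this ha

theorem readVec_ne_zero {q ℓ : ℕ} (hl : 1 ≤ ℓ) {x : List (Fin q)} (hx : x ≠ []) :
    ∀ b ∈ readVec ℓ x, b ≠ 0 := by
  intro b hb
  obtain ⟨p, hp, rfl⟩ := List.mem_map.1 hb
  rw [List.mem_range] at hp
  have := List.length_pos_iff.2 hx
  refine comp_ne_zero (List.length_pos_iff.1 ?_)
  simp only [List.length_drop, List.length_take]
  omega

theorem nucleus_nil {q : ℕ} (k ℓ : ℕ) :
    nucleus k ℓ ([] : List (Fin q)) = List.replicate ((ℓ - 1) % k) 0 := by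
  have h : readVec ℓ ([] : List (Fin q)) = List.replicate (ℓ - 1) 0 :=
    List.eq_replicate_iff.2 ⟨by simp [readVec], fun b hb => by
      obtain ⟨p, _, rfl⟩ := List.mem_map.1 hb
      funext a
      simp [comp]⟩
  rw [nucleus, h, kderiv_replicate_zero, muk_replicate_zero]

theorem nucleus_ne_nucleus_nil {q k ℓ : ℕ} (hk : 1 ≤ k) (hl : 1 ≤ ℓ) {x : List (Fin q)}
    (hx : x ≠ []) : nucleus k ℓ x ≠ nucleus k ℓ ([] : List (Fin q)) := by
  intro h
  have hne := readVec_ne_zero hl hx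
  obtain ⟨b, y, hy⟩ : ∃ b y, readVec ℓ x = b :: y := by
    refine List.exists_cons_of_length_pos ?_
    have := List.length_pos_iff.2 hx
    simp only [readVec, List.length_map, List.length_range]
    omega
  have hb : b ∈ (readVec ℓ x).take k := by
    obtain ⟨k, rfl⟩ := Nat.exists_eq_add_of_le' hk
    simp [hy]
  rw [nucleus_nil, nucleus, kderiv_eq_take_append,
    muk_append_of_forall_ne_zero fun b hb => hne b (List.mem_of_mem_take hb)] at h
  exact hne b (List.mem_of_mem_take hb)
    (List.eq_of_mem_replicate (h ▸ List.mem_append_left _ hb))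

/-- `D_k^*(R_ℓ(x)) ∩ D_k^*(R_ℓ(x')) ≠ ∅` iff
`N_{k,ℓ}(x) = N_{k,ℓ}(x')`. -/
theorem stmt_2 (q k ℓ : ℕ) (hq : 2 ≤ q) (hk : 1 ≤ k) (hl : 1 ≤ ℓ)
    (x x' : List (Fin q)) :
    (∃ z, (∃ t, TDt k t (readVec ℓ x) z) ∧ (∃ t, TDt k t (readVec ℓ x') z)) ↔
      nucleus k ℓ x = nucleus k ℓ x' := by
  simp only [exists_TDt_iff_reflTransGen]
  constructor
  · have hinv : ∀ {y z : List (Fin q → ℤ)}, Relation.ReflTransGen (TD k) y z →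
        muk k (kderiv k y) = muk k (kderiv k z) := by
      intro y z h
      induction h with
      | refl => rfl
      | tail _ h ih => exact ih.trans h.zeroInsertion_kderiv.muk_eq
    rintro ⟨z, hz, hz'⟩
    exact (hinv hz).trans (hinv hz').symm
  · intro h
    by_cases hx : x = []
    · subst hx
      have hx' : x' = [] := by
        by_contra hx'
        exact nucleus_ne_nucleus_nil hk hl hx' h.symm
      subst hx'
      exact ⟨_, .refl, .refl⟩
    · have hx' : x' ≠ [] := by
        rintro rfl
        exact nucleus_ne_nucleus_nil hk hl hx h
      have hr := reflTransGen_muk_kderiv (k := k) (readVec_ne_zero hl hx)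
      have hr' := reflTransGen_muk_kderiv (k := k) (readVec_ne_zero hl hx')
      rw [nucleus, nucleus] at h
      rw [h] at hr
      obtain ⟨c, hc, hc'⟩ := ZeroInsertion.exists_common hr hr'
      obtain ⟨z, hz, rfl⟩ := ZeroInsertion.exists_reflTransGen_TD hc
      obtain ⟨z', hz', he⟩ := ZeroInsertion.exists_reflTransGen_TD hc'
      exact ⟨z, hz, kderiv_injective hk he ▸ hz'⟩
end

section
/- Let q ≥ 2 and k, ℓ ≥ 2 be integers. Then limsup_{n→∞} (1/n)·log_q |{N_{k,ℓ}(x) : x ∈ Z_q^n}| ≤ log_q λ_{k+ℓ−2,q}. -/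
section ZeroBlocks

variable {G : Type*} [Zero G] [DecidableEq G]

lemma zeroRuns_cons_zero (y : List G) :
    zeroRuns ((0 : G) :: y) = (zeroRuns y).modifyHead (· + 1) := by
  have h := List.splitOnP_ne_nil (fun a : G => decide (a ≠ 0)) y
  unfold zeroRuns
  rw [List.splitOnP_cons_eq_if_modifyHead]
  cases hs : y.splitOnP (fun a => decide (a ≠ 0)) with
  | nil => exact absurd hs h
  | cons b t => simp

lemma zeroRuns_cons_ne {a : G} (ha : a ≠ 0) (y : List G) :
    zeroRuns (a :: y) = 0 :: zeroRuns y := by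
  unfold zeroRuns
  rw [List.splitOnP_cons_eq_if_modifyHead]
  simp [ha]

lemma map_mod_modifyHead_congr {k : ℕ} (c : ℕ) {s t : List ℕ}
    (h : s.map (· % k) = t.map (· % k)) :
    (s.modifyHead (· + c)).map (· % k) = (t.modifyHead (· + c)).map (· % k) := by
  cases s with
  | nil => cases t with
    | nil => rfl
    | cons b t => simp at h
  | cons a s => cases t with
    | nil => simp at h
    | cons b t =>
      simp only [List.map_cons, List.cons.injEq, List.modifyHead_cons] at h ⊢
      exact ⟨Nat.ModEq.add_right c h.1, h.2⟩

lemma zeroRuns_replicate_append (m : ℕ) (y : List G) :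
    zeroRuns (List.replicate m (0 : G) ++ y) = (zeroRuns y).modifyHead (· + m) := by
  induction m with
  | zero => cases h : zeroRuns y <;> simp [h]
  | succ m ih =>
    rw [List.replicate_succ, List.cons_append, zeroRuns_cons_zero, ih]
    cases zeroRuns y <;> simp [add_assoc]

lemma zeroRuns_mod_insert (k : ℕ) (a b : List G) :
    (zeroRuns (a ++ (List.replicate k (0 : G) ++ b))).map (· % k) =
      (zeroRuns (a ++ b)).map (· % k) := by
  induction a with
  | nil =>
    rw [List.nil_append, List.nil_append, zeroRuns_replicate_append]
    cases zeroRuns b <;> simp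
  | cons c a ih =>
    rw [List.cons_append, List.cons_append]
    by_cases hc : c = 0
    · subst hc
      rw [zeroRuns_cons_zero, zeroRuns_cons_zero]
      exact map_mod_modifyHead_congr 1 ih
    · rw [zeroRuns_cons_ne hc, zeroRuns_cons_ne hc, List.map_cons, List.map_cons, ih]

lemma muk_insert_replicate (k : ℕ) (a b : List G) :
    muk k (a ++ (List.replicate k (0 : G) ++ b)) = muk k (a ++ b) := by
  unfold muk
  rw [zeroRuns_mod_insert]
  simp [List.filter_append]

end ZeroBlocks

lemma kderiv_readVec {q : ℕ} (k ℓ : ℕ) (x : List (Fin q)) :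
    kderiv k (readVec ℓ x) = (List.range (x.length + ℓ - 1)).map fun p =>
      comp ((x.take (p + 1)).drop (p + 1 - ℓ)) -
        if k ≤ p then comp ((x.take (p - k + 1)).drop (p - k + 1 - ℓ)) else 0 := by
  unfold kderiv
  have hlen : (readVec ℓ x).length = x.length + ℓ - 1 := by simp [readVec]
  have hget : ∀ p < x.length + ℓ - 1, (readVec ℓ x).getD p 0 =
      comp ((x.take (p + 1)).drop (p + 1 - ℓ)) := by
    intro p hp
    rw [List.getD_eq_getElem _ _ (by omega)]
    simp [readVec]
  rw [hlen]
  refine List.map_congr_left fun p hp => ?_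
  rw [List.mem_range] at hp
  rw [hget p hp, hget (p - k) (by omega)]

/-- Removing one period from a `k`-periodic factor of length `2k+ℓ-1` keeps the nucleus. -/
lemma nucleus_remove_period {q k ℓ j : ℕ} (hl : 1 ≤ ℓ) (x : List (Fin q))
    (hj : j + 2 * k + ℓ - 1 ≤ x.length)
    (hper : (x.drop j).take (k + ℓ - 1) = (x.drop (j + k)).take (k + ℓ - 1)) :
    nucleus k ℓ (x.take j ++ x.drop (j + k)) = nucleus k ℓ x := by
  set x' := x.take j ++ x.drop (j + k) with hx'
  have hlen : x'.length = x.length - k := by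
    simp only [hx', List.length_append, List.length_take, List.length_drop]; omega
  have htj : (x.take j).length = j := by rw [List.length_take]; omega
  have hpre : x'.take (j + (k + ℓ - 1)) = x.take (j + (k + ℓ - 1)) := by
    rw [List.take_add, List.take_add, hper, hx', List.take_left' htj, List.drop_left' htj]
  have hlow : ∀ p, p < j + (k + ℓ - 1) → (x'.take (p + 1)).drop (p + 1 - ℓ) =
      (x.take (p + 1)).drop (p + 1 - ℓ) := by
    intro p hp
    have := congrArg (List.take (p + 1)) hpre
    rw [List.take_take, List.take_take, min_eq_left (by omega)] at this
    rw [this]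
  have hhigh : ∀ p, j + ℓ - 1 ≤ p → (x'.take (p + 1)).drop (p + 1 - ℓ) =
      (x.take (p + k + 1)).drop (p + k + 1 - ℓ) := by
    intro p hp
    obtain ⟨d, hd⟩ : ∃ d, p + 1 - ℓ = j + d := ⟨p + 1 - ℓ - j, by omega⟩
    have hd' : p + k + 1 - ℓ = j + k + d := by omega
    rw [hd, hd', List.drop_take, List.drop_take, ← List.drop_drop, hx', List.drop_left' htj,
      List.drop_drop]
    congr 1
    omega
  obtain ⟨a, ha⟩ : ∃ a, a = j + (k + ℓ - 1) := ⟨_, rfl⟩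
  obtain ⟨b, hb⟩ : ∃ b, x.length + ℓ - 1 = a + (k + b) :=
    ⟨x.length + ℓ - 1 - a - k, by omega⟩
  have hb' : x'.length + ℓ - 1 = a + b := by omega
  unfold nucleus
  rw [kderiv_readVec, kderiv_readVec, hb, hb', List.range_add, List.range_add, List.range_add]
  simp only [List.map_append, List.map_map]
  rw [← muk_insert_replicate]
  congr 2
  · refine List.map_congr_left fun p hp => ?_
    rw [List.mem_range] at hp
    rw [hlow p (by omega), hlow (p - k) (by omega)]
  · congr 1
    · symm
      rw [List.eq_replicate_iff]
      refine ⟨by simp, fun v hv => ?_⟩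
      rw [List.mem_map] at hv
      obtain ⟨p, hp, rfl⟩ := hv
      rw [List.mem_range] at hp
      simp only [Function.comp]
      have e1 := hlow (a + p - k) (by omega)
      have e2 := hhigh (a + p - k) (by omega)
      rw [if_pos (by omega), ← e1, e2, sub_eq_zero]
      congr 3 <;> omega
    · refine List.map_congr_left fun p hp => ?_
      simp only [Function.comp]
      have e1 := hhigh (a + p) (by omega)
      have e2 := hhigh (a + p - k) (by omega)
      rw [if_pos (by omega), if_pos (by omega), e1, e2]
      congr 4 <;> (try congr 1) <;> omega

lemma exists_fine_nucleus_eq {q k ℓ : ℕ} (hk : 1 ≤ k) (hl : 1 ≤ ℓ) :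
    ∀ (n : ℕ) (x : List (Fin q)), x.length ≤ n →
      ∃ y, Fine k ℓ y ∧ y.length ≤ n ∧ nucleus k ℓ y = nucleus k ℓ x := by
  intro n
  induction n with
  | zero =>
    intro x hx
    exact ⟨x, fun i h1 h2 => by omega, hx, rfl⟩
  | succ n ih =>
    intro x hx
    by_cases hf : Fine k ℓ x
    · exact ⟨x, hf, hx, rfl⟩
    · unfold Fine at hf
      push Not at hf
      obtain ⟨i, h1, h2, h3⟩ := hf
      obtain ⟨y, hy, hyl, hyn⟩ := ih (x.take (i - 1) ++ x.drop (i - 1 + k)) (by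
        simp only [List.length_append, List.length_take, List.length_drop]; omega)
      exact ⟨y, hy, by omega, by rw [hyn, nucleus_remove_period hl x (by omega) h3]⟩

lemma Fine.drop {q k ℓ : ℕ} (hk : 1 ≤ k) (hl : 1 ≤ ℓ) {x : List (Fin q)} (hx : Fine k ℓ x)
    (d : ℕ) :
    Fine k ℓ (x.drop d) := by
  intro i h1 h2
  rw [List.length_drop] at h2
  have := hx (d + i) (by omega) (by omega)
  have e1 : d + i - 1 = d + (i - 1) := by omega
  rw [e1, add_assoc] at this
  rwa [List.drop_drop, List.drop_drop]

/-- The words of length `n` that are `(k,ℓ)`-fine. -/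
def fineWords (q k ℓ n : ℕ) : Set (List (Fin q)) := {x | x.length = n ∧ Fine k ℓ x}

lemma fineWords_finite (q k ℓ n : ℕ) : (fineWords q k ℓ n).Finite :=
  (List.finite_length_eq (Fin q) n).subset fun _ hx => hx.1

lemma ncard_fineWords_le_pow (q k ℓ n : ℕ) : (fineWords q k ℓ n).ncard ≤ q ^ n := by
  have h : (fineWords q k ℓ n).ncard ≤ (Set.range (List.ofFn : (Fin n → Fin q) → _)).ncard := by
    refine Set.ncard_le_ncard ?_ (Set.finite_range _)
    rintro x ⟨rfl, -⟩
    exact ⟨x.get, List.ofFn_get x⟩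
  refine h.trans ?_
  rw [← Set.image_univ]
  refine (Set.ncard_image_le (Set.toFinite _)).trans ?_
  simp [Set.ncard_univ]

/-- Prepend a letter continuing a `k`-periodic pattern to the left. -/
def extendLeft {q : ℕ} (k : ℕ) : List (Fin q) → List (Fin q)
  | [] => []
  | a :: y => (a :: y).getD (k - 1) a :: a :: y

lemma extendLeft_drop {q k : ℕ} (hk : 1 ≤ k) {x : List (Fin q)} {j : ℕ} (hj : j + k < x.length)
    (h : x[j]? = x[j + k]?) : extendLeft k (x.drop (j + 1)) = x.drop j := by
  rw [List.drop_eq_getElem_cons (i := j) (by omega)]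
  cases hx : x.drop (j + 1) with
  | nil => simp at hx; omega
  | cons a y =>
    rw [extendLeft, ← hx]
    congr 1
    rw [List.getElem?_eq_getElem (by omega), List.getElem?_eq_getElem hj] at h
    rw [List.getD_eq_getElem _ _ (by simp; omega), Option.some.inj h, List.getElem_drop]
    congr 1
    omega

lemma iterate_extendLeft_drop {q k : ℕ} (hk : 1 ≤ k) {x : List (Fin q)} {i : ℕ}
    (hi : i + k ≤ x.length) (h : ∀ j < i, x[j]? = x[j + k]?) :
    (extendLeft k)^[i] (x.drop i) = x := by
  induction i with
  | zero => simp
  | succ i ih =>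
    rw [Function.iterate_succ_apply, extendLeft_drop hk (by omega) (h i (by omega))]
    exact ih (by omega) fun j hj => h j (by omega)

lemma Fine.exists_mismatch {q k ℓ : ℕ} {x : List (Fin q)}
    (hx : Fine k ℓ x) (hlen : 2 * k + ℓ - 1 ≤ x.length) (hl : 1 ≤ ℓ) :
    ∃ i < k + ℓ - 1, x[i]? ≠ x[i + k]? := by
  by_contra! hc
  refine hx 1 le_rfl (by omega) (List.ext_getElem? fun i => ?_)
  rw [List.getElem?_take, List.getElem?_take]
  split_ifs with hi
  · rw [List.getElem?_drop, List.getElem?_drop]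
    simpa [add_comm] using hc i hi
  · rfl

/-- Words of length `n + 1` obtained from a fine word by prepending a letter that differs from
the one `k` places later. -/
def mismatchCons (q k ℓ n : ℕ) : Set (List (Fin q)) :=
  {x | ∃ c y, x = c :: y ∧ y ∈ fineWords q k ℓ n ∧ y[k - 1]? ≠ some c}

lemma ncard_mismatchCons_le {q k ℓ n : ℕ} (hk : 1 ≤ k) (hn : k ≤ n) :
    (mismatchCons q k ℓ n).Finite ∧
      (mismatchCons q k ℓ n).ncard ≤ (q - 1) * (fineWords q k ℓ n).ncard := by
  classical
  set s := (fineWords_finite q k ℓ n).toFinset with hs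
  let t : Finset (List (Fin q)) := s.biUnion fun y =>
    (Finset.univ.filter fun c => y[k - 1]? ≠ some c).image fun c => c :: y
  have hst : mismatchCons q k ℓ n ⊆ (t : Set (List (Fin q))) := by
    rintro x ⟨c, y, rfl, hy, hc⟩
    simp only [t, Finset.coe_biUnion, Set.mem_iUnion, Finset.mem_coe, Finset.mem_image,
      Finset.mem_filter, Finset.mem_univ, true_and, hs, Set.Finite.mem_toFinset]
    exact ⟨y, hy, c, hc, rfl⟩
  refine ⟨t.finite_toSet.subset hst, (Set.ncard_le_ncard hst t.finite_toSet).trans ?_⟩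
  rw [Set.ncard_coe_finset, Set.ncard_eq_toFinset_card _ (fineWords_finite q k ℓ n), mul_comm]
  refine Finset.card_biUnion_le_card_mul _ _ _ fun y hy => Finset.card_image_le.trans ?_
  rw [hs, Set.Finite.mem_toFinset] at hy
  have hlt : k - 1 < y.length := by rw [hy.1]; omega
  rw [List.getElem?_eq_getElem hlt]
  have : (Finset.univ.filter fun c => some y[k - 1] ≠ some c) =
      (Finset.univ : Finset (Fin q)).erase y[k - 1] := by
    ext c; simp [eq_comm]
  rw [this, Finset.card_erase_of_mem (Finset.mem_univ _), Finset.card_univ, Fintype.card_fin]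

lemma ncard_fineWords_le_sum {q k ℓ n : ℕ} (hk : 1 ≤ k) (hl : 1 ≤ ℓ)
    (hn : 2 * k + ℓ - 1 ≤ n) :
    (fineWords q k ℓ n).ncard ≤
      ∑ i ∈ Finset.range (k + ℓ - 1), (q - 1) * (fineWords q k ℓ (n - 1 - i)).ncard := by
  have hsub : fineWords q k ℓ n ⊆ ⋃ i ∈ Finset.range (k + ℓ - 1),
      (extendLeft k)^[i] '' mismatchCons q k ℓ (n - 1 - i) := by
    rintro x ⟨hxn, hx⟩
    have hex := hx.exists_mismatch (by omega) hl
    classical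
    have hi := Nat.find_spec hex
    have hmin : ∀ j < Nat.find hex, x[j]? = x[j + k]? := fun j hj => by
      by_contra hne
      exact Nat.find_min hex hj ⟨by omega, hne⟩
    generalize Nat.find hex = i at hi hmin
    simp only [Set.mem_iUnion, Finset.mem_range, Set.mem_image]
    refine ⟨i, hi.1, x.drop i, ⟨x[i], x.drop (i + 1), List.drop_eq_getElem_cons (by omega),
      ⟨by rw [List.length_drop]; omega, hx.drop hk hl _⟩, ?_⟩,
      iterate_extendLeft_drop hk (by omega) hmin⟩
    rw [List.getElem?_drop, ← List.getElem?_eq_getElem]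
    have : i + 1 + (k - 1) = i + k := by omega
    rw [this]
    exact hi.2.symm
  have hfin : ∀ i ∈ Finset.range (k + ℓ - 1), (mismatchCons q k ℓ (n - 1 - i)).Finite ∧
      (mismatchCons q k ℓ (n - 1 - i)).ncard ≤
        (q - 1) * (fineWords q k ℓ (n - 1 - i)).ncard := fun i hi => by
    rw [Finset.mem_range] at hi
    exact ncard_mismatchCons_le hk (by omega)
  refine (Set.ncard_le_ncard hsub ?_).trans
    ((Finset.set_ncard_biUnion_le _ _).trans (Finset.sum_le_sum fun i hi => ?_))
  · exact Set.Finite.biUnion (Finset.finite_toSet _) fun i hi => (hfin i hi).1.image _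
  · exact (Set.ncard_image_le (hfin i hi).1).trans (hfin i hi).2

lemma ncard_fineWords_le {q k ℓ : ℕ} (hq : 1 ≤ q) (hk : 1 ≤ k) (hl : 1 ≤ ℓ) {μ : ℝ} (hμ : 1 ≤ μ)
    (hroot : μ ^ (k + ℓ - 1) = (q - 1) * ∑ i ∈ Finset.range (k + ℓ - 1), μ ^ i) (n : ℕ) :
    ((fineWords q k ℓ n).ncard : ℝ) ≤ (q : ℝ) ^ (2 * k + ℓ) * μ ^ n := by
  have hq1 : (1 : ℝ) ≤ q := by exact_mod_cast hq
  induction n using Nat.strong_induction_on with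
  | _ n ih =>
    by_cases hn : 2 * k + ℓ - 1 ≤ n
    · have h1 : ((fineWords q k ℓ n).ncard : ℝ) ≤ ∑ i ∈ Finset.range (k + ℓ - 1),
          ((q : ℝ) - 1) * (fineWords q k ℓ (n - 1 - i)).ncard := by
        have := ncard_fineWords_le_sum (q := q) hk hl hn
        rw [← Nat.cast_le (α := ℝ)] at this
        push_cast [Nat.cast_sub hq] at this
        exact this
      refine h1.trans ?_
      calc _ ≤ ∑ i ∈ Finset.range (k + ℓ - 1),
            ((q : ℝ) - 1) * ((q : ℝ) ^ (2 * k + ℓ) * μ ^ (n - 1 - i)) := by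
            refine Finset.sum_le_sum fun i hi => ?_
            rw [Finset.mem_range] at hi
            exact mul_le_mul_of_nonneg_left (ih _ (by omega)) (by linarith)
        _ = (q : ℝ) ^ (2 * k + ℓ) * μ ^ (n - (k + ℓ - 1)) *
            ((q - 1) * ∑ i ∈ Finset.range (k + ℓ - 1), μ ^ (k + ℓ - 1 - 1 - i)) := by
            rw [Finset.mul_sum, Finset.mul_sum]
            refine Finset.sum_congr rfl fun i hi => ?_
            rw [Finset.mem_range] at hi
            have : n - 1 - i = (n - (k + ℓ - 1)) + (k + ℓ - 1 - 1 - i) := by omega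
            rw [this, pow_add]
            ring
        _ = (q : ℝ) ^ (2 * k + ℓ) * μ ^ n := by
            rw [Finset.sum_range_reflect (fun i => μ ^ i), ← hroot, mul_assoc, ← pow_add]
            congr 2
            omega
    · have h1 : ((fineWords q k ℓ n).ncard : ℝ) ≤ (q : ℝ) ^ n := by
        exact_mod_cast ncard_fineWords_le_pow q k ℓ n
      have h2 : (q : ℝ) ^ n ≤ (q : ℝ) ^ (2 * k + ℓ) := pow_le_pow_right₀ hq1 (by omega)
      have h3 : (1 : ℝ) ≤ μ ^ n := one_le_pow₀ hμ
      have h4 : (0 : ℝ) ≤ (q : ℝ) ^ (2 * k + ℓ) := by positivity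
      nlinarith

lemma exists_root_le_lambdaRoot {q m : ℕ} (hq : 2 ≤ q) :
    ∃ μ : ℝ, 1 ≤ μ ∧ μ ≤ lambdaRoot m q ∧
      μ ^ (m + 1) = (q - 1) * ∑ i ∈ Finset.range (m + 1), μ ^ i := by
  have hq2 : (2 : ℝ) ≤ q := by exact_mod_cast hq
  let h : ℝ → ℝ := fun x => x ^ (m + 1) - (q - 1) * ∑ i ∈ Finset.range (m + 1), x ^ i
  have hc : ContinuousOn h (Set.Icc 1 q) := by
    apply Continuous.continuousOn
    fun_prop
  have h1 : h 1 ≤ 0 := by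
    have : (0 : ℝ) ≤ m := Nat.cast_nonneg m
    simp only [h, one_pow, Finset.sum_const, Finset.card_range, nsmul_eq_mul]
    push_cast
    nlinarith
  have h2 : 0 ≤ h q := by
    have := mul_geom_sum (q : ℝ) (m + 1)
    simp only [h]
    linarith
  obtain ⟨μ, ⟨hμ1, -⟩, hμ⟩ := intermediate_value_Icc (by linarith) hc ⟨h1, h2⟩
  refine ⟨μ, hμ1, le_csSup ⟨q, fun x hx => ?_⟩ ?_, by simp only [h] at hμ; linarith⟩
  · by_contra! hlt
    have hpos : 0 < x ^ (m + 1) := pow_pos (by linarith) _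
    have : x ^ (m + 2) - (q : ℝ) * x ^ (m + 1) + (q : ℝ) - 1 = 0 := hx
    rw [pow_succ x (m + 1)] at this
    nlinarith [mul_pos hpos (sub_pos.2 hlt)]
  · have hgeom := mul_geom_sum μ (m + 1)
    simp only [h] at hμ
    change μ ^ (m + 2) - (q : ℝ) * μ ^ (m + 1) + (q : ℝ) - 1 = 0
    rw [pow_succ μ (m + 1)]
    linear_combination (μ - 1) * hμ + ((q : ℝ) - 1) * hgeom

lemma ncard_nuclei_le {q k ℓ : ℕ} (hq : 1 ≤ q) (hk : 1 ≤ k) (hl : 1 ≤ ℓ) {μ : ℝ} (hμ : 1 ≤ μ)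
    (hroot : μ ^ (k + ℓ - 1) = (q - 1) * ∑ i ∈ Finset.range (k + ℓ - 1), μ ^ i) (n : ℕ) :
    ((Set.range fun x : Fin n → Fin q => nucleus k ℓ (List.ofFn x)).ncard : ℝ) ≤
      (n + 1) * ((q : ℝ) ^ (2 * k + ℓ) * μ ^ n) := by
  have hsub : (Set.range fun x : Fin n → Fin q => nucleus k ℓ (List.ofFn x)) ⊆
      ⋃ j ∈ Finset.range (n + 1), nucleus k ℓ '' fineWords q k ℓ j := by
    rintro _ ⟨x, rfl⟩
    obtain ⟨y, hy, hyl, hyn⟩ := exists_fine_nucleus_eq hk hl n (List.ofFn x) (by simp)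
    simp only [Set.mem_iUnion, Finset.mem_range]
    exact ⟨y.length, by omega, y, ⟨rfl, hy⟩, hyn⟩
  have hle : (Set.range fun x : Fin n → Fin q => nucleus k ℓ (List.ofFn x)).ncard ≤
      ∑ j ∈ Finset.range (n + 1), (fineWords q k ℓ j).ncard :=
    (Set.ncard_le_ncard hsub (Set.Finite.biUnion (Finset.finite_toSet _)
      fun j _ => (fineWords_finite q k ℓ j).image _)).trans
      ((Finset.set_ncard_biUnion_le _ _).trans
        (Finset.sum_le_sum fun j _ => Set.ncard_image_le (fineWords_finite q k ℓ j)))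
  rw [← Nat.cast_le (α := ℝ)] at hle
  push_cast at hle
  refine hle.trans ((Finset.sum_le_card_nsmul _ _ ((q : ℝ) ^ (2 * k + ℓ) * μ ^ n)
    fun j hj => ?_).trans_eq (by simp))
  rw [Finset.mem_range] at hj
  refine (ncard_fineWords_le hq hk hl hμ hroot j).trans ?_
  exact mul_le_mul_of_nonneg_left (pow_le_pow_right₀ hμ (by omega)) (by positivity)

lemma limsup_logb_div_le {b C μ : ℝ} (hb : 1 < b) (hC : 1 ≤ C) (hμ : 1 ≤ μ) {a : ℕ → ℕ}
    (ha : ∀ n, (a n : ℝ) ≤ (n + 1) * (C * μ ^ n)) :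
    Filter.limsup (fun n : ℕ => Real.logb b (a n) / n) Filter.atTop ≤ Real.logb b μ := by
  have hnonneg : ∀ n : ℕ, 0 ≤ Real.logb b (a n) := fun n => by
    rw [Real.logb]
    exact div_nonneg (Real.log_natCast_nonneg _) (Real.log_nonneg hb.le)
  have hbpos : 0 < Real.log b := Real.log_pos hb
  have hlim1 : Filter.Tendsto (fun n : ℕ => Real.log ((n : ℝ) + 1) / n) Filter.atTop (nhds 0) := by
    have h1 := (Real.isLittleO_log_id_atTop.tendsto_div_nhds_zero).comp
      (tendsto_natCast_atTop_atTop.comp (Filter.tendsto_add_atTop_nat 1))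
    have h2 := tendsto_const_nhds (x := (1 : ℝ)) (f := Filter.atTop (α := ℕ)) |>.add
      (tendsto_one_div_atTop_nhds_zero_nat (𝕜 := ℝ))
    have h3 := h1.mul h2
    rw [zero_mul] at h3
    refine h3.congr' ?_
    filter_upwards [Filter.eventually_gt_atTop 0] with n hn
    have : (0 : ℝ) < n := by exact_mod_cast hn
    simp only [Function.comp, id]
    push_cast
    field_simp
  have hlim : Filter.Tendsto (fun n : ℕ => (Real.log ((n : ℝ) + 1) / n + Real.log C / n +
      Real.log μ) / Real.log b) Filter.atTop (nhds (Real.logb b μ)) := by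
    have := ((hlim1.add (tendsto_const_div_atTop_nhds_zero_nat (Real.log C))).add_const
      (Real.log μ)).div_const (Real.log b)
    simpa [Real.logb] using this
  rw [← hlim.limsup_eq]
  refine Filter.limsup_le_limsup ?_ ?_ hlim.isBoundedUnder_le
  · filter_upwards [Filter.eventually_gt_atTop 0] with n hn
    have hn' : (0 : ℝ) < n := by exact_mod_cast hn
    have hrhs : (Real.log ((n : ℝ) + 1) / n + Real.log C / n + Real.log μ) / Real.log b =
        Real.logb b ((n + 1) * (C * μ ^ n)) / n := by
      have hμ0 : μ ≠ 0 := by positivity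
      rw [Real.logb, Real.log_mul (by positivity) (by positivity),
        Real.log_mul (by positivity) (by positivity), Real.log_pow]
      field_simp
      ring
    rw [hrhs]
    refine div_le_div_of_nonneg_right ?_ hn'.le
    rcases Nat.eq_zero_or_pos (a n) with h0 | hpos
    · rw [h0, Nat.cast_zero, Real.logb_zero]
      refine Real.logb_nonneg hb ?_
      have h1 : (1 : ℝ) ≤ C * μ ^ n := one_le_mul_of_one_le_of_one_le hC (one_le_pow₀ hμ)
      nlinarith
    · exact Real.logb_le_logb_of_le hb (by exact_mod_cast hpos) (ha n)
  · exact Filter.isCoboundedUnder_le_of_le _ fun n => div_nonneg (hnonneg n) (Nat.cast_nonneg n)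

/-- `limsup_{n→∞} (1/n)·log_q |{N_{k,ℓ}(x) : x ∈ Z_q^n}| ≤ log_q λ_{k+ℓ−2,q}`. -/
theorem stmt_12 (q k ℓ : ℕ) (hq : 2 ≤ q) (hk : 2 ≤ k) (hl : 2 ≤ ℓ) :
    Filter.limsup
        (fun n : ℕ =>
          Real.logb q
              (Set.ncard (Set.range fun x : Fin n → Fin q => nucleus k ℓ (List.ofFn x))) / n)
        Filter.atTop ≤
      Real.logb q (lambdaRoot (k + ℓ - 2) q) := by
  obtain ⟨μ, hμ1, hμ, hroot⟩ := exists_root_le_lambdaRoot (m := k + ℓ - 2) hq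
  have hr : k + ℓ - 2 + 1 = k + ℓ - 1 := by omega
  rw [hr] at hroot
  have hq1 : (1 : ℝ) < q := by exact_mod_cast (by omega : 1 < q)
  refine (limsup_logb_div_le hq1 (C := (q : ℝ) ^ (2 * k + ℓ)) (one_le_pow₀ hq1.le) hμ1
    fun n => ncard_nuclei_le (by omega) (by omega) (by omega) hμ1 hroot n).trans ?_
  exact Real.logb_le_logb_of_le hq1 (by linarith) hμ
end
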